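/- For d ≥ 2 and 0 ≤ s < q−1, the evaluation code C_E(s) on the twist E of the d-fold Segre embedding has parameters [q^d+1, (s+1)^d, q^d+1 − s(q^d−1)/(q−1)], and is permutation equivalent to an extended BCH code. -/

import Mathlib

open scoped Pointwise

/-- The Segre coordinates of `((1 : x), (1 : x ^ q), …)`, with `none` the point `(0 : 1)`. -/
def segreCoord (K : Type*) [Field K] (q d : ℕ) (ε : Fin d → Fin 2) (p : Option K) : K :=
  p.elim (if ∀ k, ε k = 1 then (1 : K) else 0)
    (fun x => ∏ k, if ε k = 0 then 1 else x ^ q ^ (k : ℕ))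

/-- The evaluation at `P¹` of the form of degree `n * ∑ k, q ^ k` restricting to `x ^ i` on the
affine line, where `i` has digits `c` in base `q`. -/
def digitMonomial (K : Type*) [Field K] (q d n : ℕ) (c : Fin d → ℕ) (p : Option K) : K :=
  p.elim (if ∀ k, c k = n then (1 : K) else 0) (fun x => x ^ ∑ k, c k * q ^ (k : ℕ))

section

variable {K : Type*} [Field K] {q d : ℕ}

lemma segreCoord_eq_digitMonomial (ε : Fin d → Fin 2) :
    segreCoord K q d ε = digitMonomial K q d 1 (fun k => (ε k : ℕ)) := by
  funext p
  cases p with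
  | none =>
    simp only [segreCoord, digitMonomial, Option.elim_none]
    exact if_congr (forall_congr' fun k => Fin.ext_iff) rfl rfl
  | some x =>
    simp only [segreCoord, digitMonomial, Option.elim_some, ← Finset.prod_pow_eq_pow_sum]
    refine Finset.prod_congr rfl fun k _ => ?_
    rcases Fin.exists_fin_two.mp ⟨ε k, rfl⟩ with h | h <;> simp [h]

lemma digitMonomial_mul {a b : ℕ} {c e : Fin d → ℕ} (hc : ∀ k, c k ≤ a) (he : ∀ k, e k ≤ b) :
    digitMonomial K q d a c * digitMonomial K q d b e = digitMonomial K q d (a + b) (c + e) := by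
  funext p
  cases p with
  | none =>
    simp only [digitMonomial, Pi.mul_apply, Option.elim_none, Pi.add_apply, ← ite_and, mul_ite,
      mul_one, mul_zero]
    refine if_congr ?_ rfl rfl
    constructor
    · rintro ⟨h₁, h₂⟩ k
      rw [h₁, h₂]
    · intro h
      exact ⟨fun k => by have := h k; have := hc k; have := he k; omega,
        fun k => by have := h k; have := hc k; have := he k; omega⟩
  | some x =>
    simp [digitMonomial, add_mul, Finset.sum_add_distrib, pow_add]

lemma range_segreCoord_pow (n : ℕ) :
    Set.range (segreCoord K q d) ^ n = {v | ∃ c, (∀ k, c k ≤ n) ∧ v = digitMonomial K q d n c} := by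
  induction n with
  | zero =>
    ext v
    simp only [pow_zero, Set.mem_one, Set.mem_ofPred_eq, nonpos_iff_eq_zero]
    have key : ∀ c : Fin d → ℕ, (∀ k, c k = 0) → digitMonomial K q d 0 c = 1 := by
      intro c hc
      funext p
      cases p <;> simp [digitMonomial, hc]
    constructor
    · rintro rfl
      exact ⟨0, fun _ => rfl, (key 0 fun _ => rfl).symm⟩
    · rintro ⟨c, hc, rfl⟩
      exact key c hc
  | succ n ih =>
    rw [pow_succ, ih]
    ext v
    simp only [Set.mem_mul, Set.mem_ofPred_eq, Set.mem_range]
    constructor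
    · rintro ⟨_, ⟨c, hc, rfl⟩, _, ⟨ε, rfl⟩, rfl⟩
      rw [segreCoord_eq_digitMonomial, digitMonomial_mul hc fun k => by omega]
      exact ⟨_, fun k => by have := hc k; simp only [Pi.add_apply]; omega, rfl⟩
    · rintro ⟨c, hc, rfl⟩
      let ε : Fin d → Fin 2 := fun k => if c k = 0 then 0 else 1
      refine ⟨_, ⟨fun k => c k - 1, fun k => Nat.sub_le_iff_le_add.mpr (hc k), rfl⟩, _,
        ⟨ε, rfl⟩, ?_⟩
      rw [segreCoord_eq_digitMonomial,
        digitMonomial_mul (fun k => Nat.sub_le_iff_le_add.mpr (hc k)) fun k => by omega]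
      congr 1
      funext k
      by_cases h : c k = 0
      · simp [ε, h]
      · simp only [ε, h, Pi.add_apply, if_false, Fin.val_one]
        omega

lemma span_segreCoord_pow (n : ℕ) :
    Submodule.span K (Set.range (segreCoord K q d)) ^ n =
      Submodule.span K {v | ∃ c, (∀ k, c k ≤ n) ∧ v = digitMonomial K q d n c} := by
  rw [Submodule.span_pow, range_segreCoord_pow]

/-- The generators of the extended code, up to complementing the digits. -/
lemma setOf_exists_digits_eq {s : ℕ} (hq : 0 < q) :
    {v : Option K → K | ∃ i : ℕ,
      (∃ c : Fin d → ℕ, (∀ k, c k ≤ s) ∧ i = ∑ k, c k * q ^ (k : ℕ)) ∧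
        v = fun p => (p.elim ((0 : K), (1 : K)) fun x => (1, x)).1 ^ i *
          (p.elim ((0 : K), (1 : K)) fun x => (1, x)).2 ^
            (s * (∑ k : Fin d, q ^ (k : ℕ)) - i)} =
      {v | ∃ c, (∀ k, c k ≤ s) ∧ v = digitMonomial K q d s c} := by
  have key (c : Fin d → ℕ) (hc : ∀ k, c k ≤ s) :
      (fun p : Option K => (p.elim ((0 : K), (1 : K)) fun x => (1, x)).1 ^
        (∑ k, c k * q ^ (k : ℕ)) * (p.elim ((0 : K), (1 : K)) fun x => (1, x)).2 ^
          (s * (∑ k : Fin d, q ^ (k : ℕ)) - ∑ k, c k * q ^ (k : ℕ))) =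
      digitMonomial K q d s fun k => s - c k := by
    funext p
    cases p with
    | none =>
      simp only [digitMonomial, Option.elim_none, zero_pow_eq, one_pow, mul_one]
      refine if_congr ?_ rfl rfl
      rw [Finset.sum_eq_zero_iff]
      simp only [Finset.mem_univ, true_imp_iff, mul_eq_zero, pow_eq_zero_iff', hq.ne', false_and,
        or_false]
      exact forall_congr' fun k => by have := hc k; omega
    | some x =>
      simp only [digitMonomial, Option.elim_some, one_pow, one_mul]
      congr 1
      rw [Finset.mul_sum, ← Finset.sum_tsub_distrib _ fun k _ => Nat.mul_le_mul_right _ (hc k)]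
      simp only [Nat.sub_mul]
  ext v
  constructor
  · rintro ⟨_, ⟨c, hc, rfl⟩, rfl⟩
    exact ⟨_, fun k => Nat.sub_le _ _, key c hc⟩
  · rintro ⟨c, hc, rfl⟩
    refine ⟨_, ⟨fun k => s - c k, fun k => Nat.sub_le _ _, rfl⟩, ?_⟩
    rw [key _ fun k => Nat.sub_le _ _]
    congr 1
    funext k
    exact (Nat.sub_sub_self (hc k)).symm

lemma linearIndependent_digitMonomial [Fintype K] (hK : Fintype.card K = q ^ d) {n : ℕ}
    (hn : n < q) :
    LinearIndependent K
      (fun c : Fin d → Fin (n + 1) => digitMonomial K q d n (fun k => (c k : ℕ))) := by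
  let e : (Fin d → Fin (n + 1)) → Fin (q ^ d) := fun c =>
    finFunctionFinEquiv fun k => Fin.castLE hn (c k)
  have he : Function.Injective e := by
    intro a b hab
    funext k
    simpa using congrFun (finFunctionFinEquiv.injective hab) k
  have he' (c) : (e c : ℕ) = ∑ k, (c k : ℕ) * q ^ (k : ℕ) := by
    simp [e]
  rw [Fintype.linearIndependent_iff]
  intro g hg c
  let P : Polynomial K := ∑ c, Polynomial.monomial (e c) (g c)
  have hdeg : P.natDegree < Fintype.card K := by
    have : P.natDegree ≤ Fintype.card K - 1 := by
      refine Polynomial.natDegree_sum_le_of_forall_le _ _ fun c _ =>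
        (Polynomial.natDegree_monomial_le _).trans ?_
      have := (e c).isLt
      omega
    have := Fintype.card_pos (α := K)
    omega
  have hP : P = 0 := by
    refine Polynomial.eq_zero_of_natDegree_lt_card_of_eval_eq_zero P Function.injective_id
      (fun x => ?_) hdeg
    have := congrFun hg (some x)
    simpa [P, Polynomial.eval_finsetSum, he', digitMonomial] using this
  have hc : P.coeff (e c) = g c := by
    simp only [P, Polynomial.finsetSum_coeff, Polynomial.coeff_monomial]
    rw [Finset.sum_eq_single c] <;> simp +contextual [Fin.val_inj, he.eq_iff]
  rw [← hc, hP, Polynomial.coeff_zero]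

lemma finrank_span_digitMonomial [Fintype K] (hK : Fintype.card K = q ^ d) {n : ℕ} (hn : n < q) :
    Module.finrank K (Submodule.span K
      {v | ∃ c, (∀ k, c k ≤ n) ∧ v = digitMonomial K q d n c}) = (n + 1) ^ d := by
  have hset : {v | ∃ c, (∀ k, c k ≤ n) ∧ v = digitMonomial K q d n c} = Set.range
      fun c : Fin d → Fin (n + 1) => digitMonomial K q d n (fun k => (c k : ℕ)) := by
    ext v
    constructor
    · rintro ⟨c, hc, rfl⟩
      exact ⟨fun k => ⟨c k, by have := hc k; omega⟩, rfl⟩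
    · rintro ⟨c, rfl⟩
      exact ⟨_, fun k => by omega, rfl⟩
  rw [hset, finrank_span_eq_card (linearIndependent_digitMonomial hK hn), Fintype.card_fun,
    Fintype.card_fin, Fintype.card_fin]

lemma exists_polynomial_of_mem_span_digitMonomial {n : ℕ} {v : Option K → K}
    (hv : v ∈ Submodule.span K {v | ∃ c, (∀ k, c k ≤ n) ∧ v = digitMonomial K q d n c})
    (hq : 0 < q) :
    ∃ P : Polynomial K, P.natDegree ≤ n * ∑ k : Fin d, q ^ (k : ℕ) ∧
      v none = P.coeff (n * ∑ k : Fin d, q ^ (k : ℕ)) ∧ ∀ x, v (some x) = P.eval x := by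
  induction hv using Submodule.span_induction with
  | mem v hv =>
    obtain ⟨c, hc, rfl⟩ := hv
    have hle (k : Fin d) : c k * q ^ (k : ℕ) ≤ n * q ^ (k : ℕ) := Nat.mul_le_mul_right _ (hc k)
    refine ⟨Polynomial.X ^ ∑ k, c k * q ^ (k : ℕ), ?_, ?_, fun x => by simp [digitMonomial]⟩
    · rw [Polynomial.natDegree_X_pow, Finset.mul_sum]
      exact Finset.sum_le_sum fun k _ => hle k
    · rw [Polynomial.coeff_X_pow, Finset.mul_sum]
      simp only [digitMonomial, Option.elim_none]
      refine if_congr ?_ rfl rfl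
      rw [eq_comm (a := ∑ k : Fin d, n * q ^ (k : ℕ)),
        Finset.sum_eq_sum_iff_of_le fun k _ => hle k]
      simp [hq.ne']
  | zero => exact ⟨0, by simp⟩
  | add v w _ _ hv hw =>
    obtain ⟨P, hP, hP₀, hPx⟩ := hv
    obtain ⟨Q, hQ, hQ₀, hQx⟩ := hw
    exact ⟨P + Q, Polynomial.natDegree_add_le_of_degree_le hP hQ, by simp [hP₀, hQ₀],
      fun x => by simp [hPx, hQx]⟩
  | smul a v _ hv =>
    obtain ⟨P, hP, hP₀, hPx⟩ := hv
    exact ⟨a • P, (Polynomial.natDegree_smul_le a P).trans hP, by simp [hP₀],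
      fun x => by simp [hPx]⟩

/-- A nonzero form of degree `m` on the projective line has at most `m` zeros. -/
lemma card_sub_le_hammingNorm [Fintype K] [DecidableEq K] {m : ℕ} {v : Option K → K} (hv : v ≠ 0)
    {P : Polynomial K} (hP : P.natDegree ≤ m) (h₀ : v none = P.coeff m)
    (hx : ∀ x, v (some x) = P.eval x) :
    Fintype.card K + 1 - m ≤ hammingNorm v := by
  have hP0 : P ≠ 0 := by
    rintro rfl
    refine hv (funext fun p => ?_)
    cases p <;> simp [h₀, hx]
  have hsplit := Finset.card_filter_add_card_filter_not (s := Finset.univ) (fun p => v p = 0)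
  rw [Finset.card_univ, Fintype.card_option] at hsplit
  have hroots : (Finset.univ.filter fun x : K => v (some x) = 0).card ≤ P.natDegree := by
    refine (Finset.card_le_card ?_).trans
      ((Multiset.toFinset_card_le P.roots).trans (Polynomial.card_roots' P))
    intro x h
    simp only [Finset.mem_filter, hx] at h
    simpa [hP0] using h.2
  have hzeros : (Finset.univ.filter fun p => v p = 0).card ≤ m := by
    rw [Finset.card_filter, Fintype.sum_option, ← Finset.card_filter]
    split_ifs with h
    · have : P.natDegree ≠ m := by
        rintro rfl
        exact hP0 (Polynomial.leadingCoeff_eq_zero.mp (h₀.symm.trans h))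
      omega
    · omega
  change _ ≤ (Finset.univ.filter fun p => ¬ v p = 0).card
  omega

end

section

variable {F K ι : Type*} [Field F] [Field K] [Algebra F K]

lemma LinearIndependent.of_forall_mem_range_algebraMap {κ : Type*} {v : κ → ι → K}
    (hv : LinearIndependent F v) (hr : ∀ i p, v i p ∈ Set.range (algebraMap F K)) :
    LinearIndependent K v := by
  choose w hw using hr
  let b := Module.Basis.ofVectorSpace F K
  rw [linearIndependent_iff'] at hv ⊢
  intro s g hg i hi
  refine b.ext_elem fun j => ?_
  rw [map_zero, Finsupp.zero_apply]
  refine hv s (fun i => b.coord j (g i)) (funext fun p => ?_) i hi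
  have h := congrArg (b.coord j) (congrFun hg p)
  simp only [Finset.sum_apply, Pi.smul_apply, ← hw, smul_eq_mul, Pi.zero_apply, map_zero,
    map_sum] at h ⊢
  have h' (i) : b.coord j (g i * algebraMap F K (w i p)) = w i p * b.coord j (g i) := by
    rw [mul_comm, ← Algebra.smul_def, map_smul, smul_eq_mul]
  simp only [h'] at h
  simp only [Algebra.smul_def, ← map_mul, ← map_sum]
  rw [← map_zero (algebraMap F K), ← h]
  simp only [mul_comm]

lemma finrank_span_of_forall_mem_range_algebraMap [Finite ι] [FiniteDimensional F K]
    (U : Submodule F (ι → K)) (hU : ∀ v ∈ U, ∀ p, v p ∈ Set.range (algebraMap F K)) :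
    Module.finrank K (Submodule.span K (U : Set (ι → K))) = Module.finrank F U := by
  let b := Module.finBasis F U
  have hb : LinearIndependent F fun i => (b i : ι → K) :=
    b.linearIndependent.map' U.subtype U.ker_subtype
  have hK := hb.of_forall_mem_range_algebraMap fun i => hU _ (b i).2
  have hspan : Submodule.span F (Set.range fun i => (b i : ι → K)) = U := by
    have := congrArg (Submodule.map U.subtype) b.span_eq
    rwa [Submodule.map_span, ← Set.range_comp, Submodule.map_top, Submodule.range_subtype] at this
  have h := finrank_span_eq_card hK
  rw [Fintype.card_fin, ← Submodule.span_span_of_tower F, hspan] at h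
  exact h

lemma span_range_eq_of_isUnit_det {κ : Type*} [Fintype κ] [DecidableEq κ] {A : Matrix κ κ K}
    (hA : IsUnit A.det) {y z : κ → ι → K} (h : ∀ p, (fun ε => y ε p) = A⁻¹.mulVec fun ε => z ε p) :
    Submodule.span K (Set.range y) = Submodule.span K (Set.range z) := by
  have h' (p) : (fun ε => z ε p) = A.mulVec fun ε => y ε p := by
    rw [h, Matrix.mulVec_mulVec, Matrix.mul_nonsing_inv A hA, Matrix.one_mulVec]
  have key {B : Matrix κ κ K} {y z : κ → ι → K}
      (h : ∀ p, (fun ε => y ε p) = B.mulVec fun ε => z ε p) :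
      Submodule.span K (Set.range y) ≤ Submodule.span K (Set.range z) := by
    rw [Submodule.span_le]
    rintro _ ⟨ε, rfl⟩
    have : y ε = ∑ δ, B ε δ • z δ := by
      funext p
      simpa [Matrix.mulVec, dotProduct] using congrFun (h p) ε
    rw [this]
    exact Submodule.sum_mem _ fun δ _ => Submodule.smul_mem _ _ (Submodule.subset_span ⟨δ, rfl⟩)
  exact le_antisymm (key h) (key h')

lemma range_pow_subset_eval_isHomogeneous {κ : Type*} (y : ι → κ → K) (n : ℕ) :
    Set.range (fun ε p => y p ε) ^ n ⊆ {v | ∃ f : MvPolynomial κ F, f.IsHomogeneous n ∧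
      v = fun p => MvPolynomial.eval (y p) (MvPolynomial.map (algebraMap F K) f)} := by
  induction n with
  | zero =>
    rw [pow_zero]
    rintro _ rfl
    exact ⟨1, MvPolynomial.isHomogeneous_one _ _, by funext p; simp⟩
  | succ n ih =>
    rw [pow_succ]
    rintro _ ⟨v, hv, _, ⟨ε, rfl⟩, rfl⟩
    obtain ⟨f, hf, rfl⟩ := ih hv
    exact ⟨f * MvPolynomial.X ε, hf.mul (MvPolynomial.isHomogeneous_X _ _), by funext p; simp⟩

lemma eval_mem_span_pow {κ : Type*} [Fintype κ] (y : ι → κ → K) {n : ℕ} {f : MvPolynomial κ K}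
    (hf : f.IsHomogeneous n) :
    (fun p => MvPolynomial.eval (y p) f) ∈
      Submodule.span K (Set.range fun ε p => y p ε) ^ n := by
  classical
  have : (fun p => MvPolynomial.eval (y p) f) =
      ∑ t ∈ f.support, f.coeff t • ∏ ε, (fun p => y p ε) ^ t ε := by
    funext p
    simp [MvPolynomial.eval_eq']
  rw [this]
  refine Submodule.sum_mem _ fun t ht => Submodule.smul_mem _ _ ?_
  have ht' : ∑ ε, t ε = n := by
    rw [← Finsupp.degree_eq_sum]
    by_contra hne
    exact MvPolynomial.mem_support_iff.mp ht (hf.coeff_eq_zero hne)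
  rw [← ht', ← Finset.prod_pow_eq_pow_sum]
  induction (Finset.univ : Finset κ) using Finset.induction_on with
  | empty => exact Submodule.one_le.mp le_rfl
  | insert ε s hε ih =>
    rw [Finset.prod_insert hε, Finset.prod_insert hε]
    exact Submodule.mul_mem_mul
      (Submodule.pow_mem_pow _ (Submodule.subset_span (Set.mem_range_self ε)) _) ih

lemma span_eval_isHomogeneous {κ : Type*} [Fintype κ] (y : ι → κ → K) (n : ℕ) :
    Submodule.span K (Submodule.span F {v | ∃ f : MvPolynomial κ F, f.IsHomogeneous n ∧
      v = fun p => MvPolynomial.eval (y p) (MvPolynomial.map (algebraMap F K) f)} :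
        Set (ι → K)) = Submodule.span K (Set.range fun ε p => y p ε) ^ n := by
  rw [Submodule.span_span_of_tower]
  refine le_antisymm (Submodule.span_le.mpr ?_) ?_
  · rintro _ ⟨f, hf, rfl⟩
    exact eval_mem_span_pow y (hf.map _)
  · rw [Submodule.span_pow]
    exact Submodule.span_mono (range_pow_subset_eval_isHomogeneous y n)

lemma eval_mem_range_algebraMap {κ : Type*} {y : ι → κ → K}
    (hy : ∀ p ε, y p ε ∈ Set.range (algebraMap F K)) {n : ℕ} :
    ∀ v ∈ Submodule.span F {v | ∃ f : MvPolynomial κ F, f.IsHomogeneous n ∧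
      v = fun p => MvPolynomial.eval (y p) (MvPolynomial.map (algebraMap F K) f)},
      ∀ p, v p ∈ Set.range (algebraMap F K) := by
  intro v hv p
  induction hv using Submodule.span_induction with
  | mem v hv =>
    obtain ⟨f, -, rfl⟩ := hv
    choose w hw using hy
    refine ⟨MvPolynomial.eval (w p) f, ?_⟩
    have hp : y p = algebraMap F K ∘ w p := funext fun ε => (hw p ε).symm
    simp only [hp, MvPolynomial.eval_map]
    exact MvPolynomial.eval₂_comp (algebraMap F K) (w p) f
  | zero => exact ⟨0, map_zero _⟩
  | add v w _ _ hv hw =>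
    obtain ⟨a, ha⟩ := hv
    obtain ⟨b, hb⟩ := hw
    exact ⟨a + b, by simp [ha, hb]⟩
  | smul c v _ hv =>
    obtain ⟨a, ha⟩ := hv
    exact ⟨c * a, by simp [ha, Algebra.smul_def]⟩

end

section

variable {F K : Type*} [Field F] [Field K] [Algebra F K] [Fintype K] {q d : ℕ}

/-- The fibres over `Fˣ` of the norm from `K` to `F` all have size `(q ^ d - 1) / (q - 1)`. -/
lemma card_filter_pow_geomSum_eq [Fintype F] [DecidableEq K]
    (hF : Fintype.card F = q) (hK : Fintype.card K = q ^ d) {a : F} (ha : a ≠ 0) :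
    (Finset.univ.filter fun x : K =>
      x ^ (∑ k : Fin d, q ^ (k : ℕ)) = algebraMap F K a).card = ∑ k : Fin d, q ^ (k : ℕ) := by
  classical
  have hq : 1 < q := hF ▸ Fintype.one_lt_card
  have hnorm (x : K) : x ^ (∑ k : Fin d, q ^ (k : ℕ)) = algebraMap F K (Algebra.norm F x) := by
    rw [FiniteField.algebraMap_norm_eq_pow, Nat.card_eq_fintype_card, Nat.card_eq_fintype_card,
      hF, hK, Fin.sum_univ_eq_sum_range (fun k => q ^ k), Nat.geomSum_eq hq]
  have hmul : (∑ k : Fin d, q ^ (k : ℕ)) * (q - 1) = q ^ d - 1 := by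
    rw [Fin.sum_univ_eq_sum_range (fun k => q ^ k), geom_sum_mul_of_one_le hq.le]
  have hpos : 0 < ∑ k : Fin d, q ^ (k : ℕ) := by
    refine Nat.pos_of_ne_zero fun h => ?_
    have := Fintype.one_lt_card (α := K)
    rw [h] at hmul
    omega
  set M := ∑ k : Fin d, q ^ (k : ℕ)
  have hle (b : F) (_ : b ∈ Finset.univ.erase (0 : F)) :
      ((Finset.univ.erase (0 : K)).filter fun x => Algebra.norm F x = b).card ≤ M := by
    refine (Finset.card_le_card ?_).trans
      ((Multiset.toFinset_card_le _).trans (Polynomial.card_nthRoots M (algebraMap F K b)))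
    intro x hx
    rw [Multiset.mem_toFinset, Polynomial.mem_nthRoots hpos, hnorm, (Finset.mem_filter.mp hx).2]
  have hsum := Finset.card_eq_sum_card_fiberwise (s := Finset.univ.erase (0 : K))
    (t := Finset.univ.erase (0 : F)) (f := Algebra.norm F) fun x hx => by
      simpa [Algebra.norm_eq_zero_iff] using hx
  rw [Finset.card_erase_of_mem (Finset.mem_univ _), Finset.card_univ, hK, ← hmul] at hsum
  have hconst : ∑ b ∈ Finset.univ.erase (0 : F), M = M * (q - 1) := by
    rw [Finset.sum_const, Finset.card_erase_of_mem (Finset.mem_univ _), Finset.card_univ, hF,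
      smul_eq_mul, mul_comm]
  have heq := (Finset.sum_eq_sum_iff_of_le hle).mp (hsum.symm.trans hconst.symm) a (by simpa)
  refine Eq.trans (congrArg Finset.card (Finset.ext fun x => ?_)) heq
  simp only [Finset.mem_filter, Finset.mem_univ, true_and, Finset.mem_erase, and_true, hnorm,
    (algebraMap F K).injective.eq_iff]
  refine ⟨fun h => ⟨?_, h⟩, And.right⟩
  rintro rfl
  exact ha (h.symm.trans (Algebra.norm_zero))

/-- A product of `s` translates of the norm form has the maximal number of zeros. -/
lemma exists_mem_span_digitMonomial_hammingNorm_eq [Fintype F] [DecidableEq K]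
    (hF : Fintype.card F = q) (hK : Fintype.card K = q ^ d) (hd : d ≠ 0) {s : ℕ} (hs : s < q) :
    ∃ v ∈ Submodule.span K {v | ∃ c, (∀ k, c k ≤ s) ∧ v = digitMonomial K q d s c}, v ≠ 0 ∧
      hammingNorm v = q ^ d + 1 - s * ∑ k : Fin d, q ^ (k : ℕ) ∧
      ∀ p, v p ∈ Set.range (algebraMap F K) := by
  classical
  have hq : 1 < q := hF ▸ Fintype.one_lt_card
  obtain ⟨S, hS, hcard⟩ := Finset.exists_subset_card_eq
    (s := Finset.univ.erase (0 : F)) (n := s) (by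
      rw [Finset.card_erase_of_mem (Finset.mem_univ _), Finset.card_univ, hF]
      omega)
  have hnone : (∏ a ∈ S, (segreCoord K q d 1 - algebraMap F K a • segreCoord K q d 0)) none = 1 := by
    have : ¬ (Fin d → False) := fun h => h ⟨0, Nat.pos_of_ne_zero hd⟩
    simp [segreCoord, this]
  have hsome (x : K) :
      (∏ a ∈ S, (segreCoord K q d 1 - algebraMap F K a • segreCoord K q d 0)) (some x) =
        ∏ a ∈ S, (x ^ (∑ k : Fin d, q ^ (k : ℕ)) - algebraMap F K a) := by
    simp [segreCoord, Finset.prod_pow_eq_pow_sum, Algebra.smul_def]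
  refine ⟨∏ a ∈ S, (segreCoord K q d 1 - algebraMap F K a • segreCoord K q d 0), ?_, ?_, ?_, ?_⟩
  · rw [← span_segreCoord_pow, ← hcard]
    clear hnone hsome hcard hS
    induction S using Finset.induction_on with
    | empty => exact Submodule.one_le.mp le_rfl
    | insert a S ha ih =>
      rw [Finset.prod_insert ha, Finset.card_insert_of_notMem ha, pow_succ']
      exact Submodule.mul_mem_mul (Submodule.sub_mem _ (Submodule.subset_span ⟨_, rfl⟩)
        (Submodule.smul_mem _ _ (Submodule.subset_span ⟨_, rfl⟩))) ih
  · intro h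
    rw [h] at hnone
    exact zero_ne_one hnone
  · generalize hv : ∏ a ∈ S, (segreCoord K q d 1 - algebraMap F K a • segreCoord K q d 0) = v at *
    have hsplit := Finset.card_filter_add_card_filter_not (s := Finset.univ) (fun p => v p = 0)
    have hzeros : (Finset.univ.filter fun x : K => v (some x) = 0) = S.biUnion fun a =>
        Finset.univ.filter fun x : K => x ^ (∑ k : Fin d, q ^ (k : ℕ)) = algebraMap F K a := by
      ext x
      simp [hsome, Finset.prod_eq_zero_iff, sub_eq_zero]
    have hzcard : (Finset.univ.filter fun p => v p = 0).card = s * ∑ k : Fin d, q ^ (k : ℕ) := by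
      rw [Finset.card_filter, Fintype.sum_option, ← Finset.card_filter, hnone,
        if_neg one_ne_zero, zero_add, hzeros, Finset.card_biUnion]
      · rw [Finset.sum_congr rfl fun a ha =>
          card_filter_pow_geomSum_eq hF hK (Finset.mem_erase.mp (hS ha)).1]
        rw [Finset.sum_const, hcard, smul_eq_mul]
      · intro a _ b _ hab
        refine Finset.disjoint_filter.mpr fun x _ h₁ h₂ => hab ?_
        exact (algebraMap F K).injective (h₁.symm.trans h₂)
    rw [hzcard, Finset.card_univ, Fintype.card_option, hK] at hsplit
    change (Finset.univ.filter fun p => ¬ v p = 0).card = _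
    omega
  · intro p
    cases p with
    | none => exact ⟨1, by rw [hnone, map_one]⟩
    | some x =>
      refine ⟨∏ a ∈ S, (Algebra.norm F x - a), ?_⟩
      rw [hsome, map_prod]
      refine Finset.prod_congr rfl fun a _ => ?_
      rw [map_sub, FiniteField.algebraMap_norm_eq_pow, Nat.card_eq_fintype_card,
        Nat.card_eq_fintype_card, hF, hK, Fin.sum_univ_eq_sum_range (fun k => q ^ k),
        Nat.geomSum_eq hq]

end

/-- For `d ≥ 2` and `0 ≤ s < q-1`, the evaluation code `C_E(s)` on the twist `E` of
the `d`-fold Segre embedding of `P¹` over `F_q` has parameters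
`[q^d+1, (s+1)^d, q^d+1 - s(q^d-1)/(q-1)]`, and is permutation equivalent to an
extended BCH code.  Here `E(F_q)` is parametrised by `P¹(F_{q^d})` through
`Φ = μ_tw⁻¹ ∘ φ_s ∘ φ_f`, `(x:y) ↦ μ_tw⁻¹ ∘ φ_s((x:y),(x^q:y^q),…)`, where the
twisting matrix `μ_tw` is invertible over `F_{q^d}`, the points `Φ p` have
`F_q`-rational coordinates, and `Φ` is injective. -/
theorem stmt_18 (F K : Type) [Field F] [Field K] [Algebra F K]
    [Fintype F] [Fintype K] [DecidableEq K] (q s d : ℕ)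
    (hqF : Fintype.card F = q) (hqK : Fintype.card K = q ^ d)
    (hd : 2 ≤ d) (hs : s + 1 < q)
    (μ : Matrix (Fin d → Fin 2) (Fin d → Fin 2) K) (hμ : IsUnit μ.det)
    (Φ : Option K → ((Fin d → Fin 2) → K))
    -- Φ = μ_tw⁻¹ ∘ φ_s ∘ φ_f on the points (x:1), x ∈ F_{q^d}, and (1:0) of P¹
    (hΦ : ∀ p, Φ p = μ⁻¹.mulVec (p.elim
      (fun ε => if ∀ k, ε k = 1 then (1 : K) else 0)
      (fun x ε => ∏ k, if ε k = 0 then 1 else x ^ q ^ (k : ℕ))))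
    -- the points Φ p are the F_q-rational points of the twist E
    (hrat : ∀ p ε, Φ p ε ∈ Set.range (algebraMap F K))
    (hinj : Function.Injective Φ) :
    let m := s * (q ^ d - 1) / (q - 1)
    -- the evaluation code C_E(s): evaluations of degree-s forms over F_q at E(F_q)
    let CE : Submodule F (Option K → K) := Submodule.span F
      {v | ∃ f : MvPolynomial (Fin d → Fin 2) F, f.IsHomogeneous s ∧
        v = fun p => MvPolynomial.eval (Φ p) (MvPolynomial.map (algebraMap F K) f)}
    -- the extended BCH code B₀^{ext}(s) of length q^d + 1
    let pt : Option K → K × K := fun o => o.elim (0, 1) fun x => (1, x)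
    let Bext : Submodule K (Option K → K) := Submodule.span K
      {v | ∃ i : ℕ, (∃ c : Fin d → ℕ, (∀ k, c k ≤ s) ∧ i = ∑ k, c k * q ^ (k : ℕ)) ∧
        v = fun p => (pt p).1 ^ i * (pt p).2 ^ (m - i)}
    let B₀ : Submodule F (Option K → K) := Bext.restrictScalars F ⊓
      Submodule.pi Set.univ fun _ => LinearMap.range (Algebra.linearMap F K)
    Fintype.card (Option K) = q ^ d + 1 ∧
    Module.finrank F CE = (s + 1) ^ d ∧
    (∃ c ∈ CE, c ≠ 0 ∧ hammingNorm c = q ^ d + 1 - m) ∧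
    (∀ c ∈ CE, c ≠ 0 → q ^ d + 1 - m ≤ hammingNorm c) ∧
    -- permutation equivalence with the extended BCH code
    (∃ e : Option K ≃ Option K, ∀ v : Option K → K,
      v ∈ CE ↔ (fun p => v (e p)) ∈ B₀) := by
  intro m CE pt Bext B₀
  have hm : m = s * ∑ k : Fin d, q ^ (k : ℕ) := by
    have hmul : (∑ k : Fin d, q ^ (k : ℕ)) * (q - 1) = q ^ d - 1 := by
      rw [Fin.sum_univ_eq_sum_range (fun k => q ^ k), geom_sum_mul_of_one_le (by omega)]
    change s * (q ^ d - 1) / (q - 1) = _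
    rw [← hmul, ← mul_assoc, Nat.mul_div_cancel _ (by omega)]
  have hBext : Bext =
      Submodule.span K {v | ∃ c, (∀ k, c k ≤ s) ∧ v = digitMonomial K q d s c} := by
    rw [← setOf_exists_digits_eq (by omega), ← hm]
  have hCEspan : Submodule.span K (CE : Set (Option K → K)) = Bext := by
    rw [span_eval_isHomogeneous, hBext, ← span_segreCoord_pow,
      span_range_eq_of_isUnit_det (z := segreCoord K q d) hμ fun p => ?_]
    rw [hΦ]
    cases p <;> rfl
  have hCErat : ∀ v ∈ CE, ∀ p, v p ∈ Set.range (algebraMap F K) := eval_mem_range_algebraMap hrat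
  have hB₀rat : ∀ v ∈ B₀, ∀ p, v p ∈ Set.range (algebraMap F K) :=
    fun v hv p => hv.2 p (Set.mem_univ p)
  have hBdim : Module.finrank K Bext = (s + 1) ^ d :=
    hBext ▸ finrank_span_digitMonomial hqK (by omega)
  have hCEdim : Module.finrank F CE = (s + 1) ^ d := by
    rw [← finrank_span_of_forall_mem_range_algebraMap CE hCErat, hCEspan, hBdim]
  have hle : CE ≤ B₀ := fun v hv =>
    ⟨hCEspan ▸ Submodule.subset_span hv, fun p _ => hCErat v hv p⟩
  have hCE : CE = B₀ := by
    refine Submodule.eq_of_le_of_finrank_le hle ?_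
    rw [hCEdim, ← hBdim, ← finrank_span_of_forall_mem_range_algebraMap B₀ hB₀rat]
    exact Submodule.finrank_mono (Submodule.span_le.mpr fun v hv => hv.1)
  refine ⟨by rw [Fintype.card_option, hqK], hCEdim, ?_, ?_, Equiv.refl _, fun v => ?_⟩
  · obtain ⟨v, hv, hv0, hnorm, hvrat⟩ :=
      exists_mem_span_digitMonomial_hammingNorm_eq hqF hqK (by omega) (s := s) (by omega)
    exact ⟨v, hCE ▸ ⟨hBext ▸ hv, fun p _ => hvrat p⟩, hv0, by rw [hnorm, hm]⟩
  · intro v hv hv0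
    obtain ⟨P, hP, h₀, hx⟩ := exists_polynomial_of_mem_span_digitMonomial
      (hBext ▸ (hle hv).1 : v ∈ Submodule.span K _) (by omega)
    rw [hm, ← hqK]
    exact card_sub_le_hammingNorm hv0 hP h₀ hx
  · rw [hCE]
    rfl
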